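/- arXiv:2502.18069 — 3 statements merged into one kernel-verified Lean document; each statement's English description precedes it below -/
import Mathlib

section
/- Let C = aC_a ⊕ bC_b be a linear code of length n over H_32, where C_a is a binary linear code and C_b a ternary linear code. Then C^⊥ = a𝔽_2^n ⊕ bC_b^⊥, where C_b^⊥ is the dual of C_b in 𝔽_3^n. Moreover (C^⊥)^⊥ = C if and only if C_a = 𝔽_2^n. -/
/-!
Common setup: the non-unital rings `H₂₃` and `H₃₂` of order 6, whose common
additive group is `ZMod 2 × ZMod 3`, and codes over them.
-/

/-- The common additive group of the rings `H₂₃` and `H₃₂`. -/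
abbrev Hring : Type := ZMod 2 × ZMod 3

/-- The element `a = (1,0)` of `H`. -/
def aH : Hring := (1, 0)

/-- The element `b = (0,1)` of `H`. -/
def bH : Hring := (0, 1)

/-- Multiplication of the non-unital ring `H₂₃`: `(x₁,y₁)·(x₂,y₂) = (x₁x₂, 0)`. -/
def mul23 (u v : Hring) : Hring := (u.1 * v.1, 0)

/-- Multiplication of the non-unital ring `H₃₂`: `(x₁,y₁)·(x₂,y₂) = (0, y₁y₂)`. -/
def mul32 (u v : Hring) : Hring := (0, u.2 * v.2)

/-- The vector `a·x` associated with a binary vector `x`: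
`(a·x)_j = a` if `x_j = 1` and `0` otherwise, i.e. `(a·x)_j = (x_j, 0)`. -/
def aVec {n : ℕ} (x : Fin n → ZMod 2) : Fin n → Hring := fun j => (x j, 0)

/-- The vector `b·y` associated with a ternary vector `y`:
`(b·y)_j = 0, b, 2b` according as `y_j = 0, 1, 2`, i.e. `(b·y)_j = (0, y_j)`. -/
def bVec {n : ℕ} (y : Fin n → ZMod 3) : Fin n → Hring := fun j => (0, y j)

/-- The code `a C_a ⊕ b C_b = {a·x + b·y : x ∈ C_a, y ∈ C_b}` over `H`. -/
def combCode {n : ℕ} (Ca : Set (Fin n → ZMod 2)) (Cb : Set (Fin n → ZMod 3)) :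
    Set (Fin n → Hring) :=
  { c | ∃ x ∈ Ca, ∃ y ∈ Cb, c = aVec x + bVec y }

/-- Inner product on `H^n` with respect to the multiplication `mul`. -/
def innerH {n : ℕ} (mul : Hring → Hring → Hring) (x y : Fin n → Hring) : Hring :=
  ∑ i, mul (x i) (y i)

/-- Standard inner product on `F^n`. -/
def innerF {F : Type*} [CommRing F] {n : ℕ} (x y : Fin n → F) : F :=
  ∑ i, x i * y i

/-- Dual of a code in `H^n` with respect to the multiplication `mul`. -/
def dualH {n : ℕ} (mul : Hring → Hring → Hring) (C : Set (Fin n → Hring)) :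
    Set (Fin n → Hring) :=
  { y | ∀ x ∈ C, innerH mul x y = 0 }

/-- Dual of a code in `F^n` with respect to the standard inner product. -/
def dualF {F : Type*} [CommRing F] {n : ℕ} (C : Set (Fin n → F)) : Set (Fin n → F) :=
  { y | ∀ x ∈ C, innerF x y = 0 }

/-- A linear code over `(H, mul)`: a nonempty subset of `H^n` closed under
componentwise addition and under (componentwise) multiplication by each ring element. -/
def IsLinearCode {n : ℕ} (mul : Hring → Hring → Hring) (C : Set (Fin n → Hring)) : Prop :=
  C.Nonempty ∧ (∀ u ∈ C, ∀ v ∈ C, u + v ∈ C) ∧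
    ∀ r : Hring, ∀ u ∈ C, (fun i => mul r (u i)) ∈ C

/-- Self-orthogonality of a code in `H^n`. -/
def SelfOrthH {n : ℕ} (mul : Hring → Hring → Hring) (C : Set (Fin n → Hring)) : Prop :=
  ∀ x ∈ C, ∀ y ∈ C, innerH mul x y = 0

/-- Self-orthogonality of a code over a finite field. -/
def SelfOrthF {F : Type*} [CommRing F] {n : ℕ} (C : Set (Fin n → F)) : Prop :=
  ∀ x ∈ C, ∀ y ∈ C, innerF x y = 0

/-- A quasi self-dual (QSD) code: self-orthogonal with `|C| = 6^(n/2)`. -/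
def QSD {n : ℕ} (mul : Hring → Hring → Hring) (C : Set (Fin n → Hring)) : Prop :=
  SelfOrthH mul C ∧ (Nat.card C : ℝ) = (6 : ℝ) ^ ((n : ℝ) / 2)

/-- Hamming weight: the number of nonzero coordinates. -/
def wt {β : Type*} [Zero β] [DecidableEq β] {n : ℕ} (v : Fin n → β) : ℕ :=
  (Finset.univ.filter (fun i => v i ≠ 0)).card

/-- `d` is the minimum distance of the code `C`: `d` is the least Hamming weight of a
nonzero codeword. -/
def IsMinDist {β : Type*} [Zero β] [DecidableEq β] {n : ℕ}
    (C : Set (Fin n → β)) (d : ℕ) : Prop :=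
  (∃ v ∈ C, v ≠ 0 ∧ wt v = d) ∧ ∀ v ∈ C, v ≠ 0 → d ≤ wt v

/-- A code is cyclic if it is closed under the cyclic shift
`(c₁, …, c_n) ↦ (c_n, c₁, …, c_{n-1})`. -/
def IsCyclicCode {β : Type*} {n : ℕ} (C : Set (Fin n → β)) : Prop :=
  ∀ c ∈ C, (fun i : Fin n => c ((finRotate n).symm i)) ∈ C

/-- The linear code over `(H, mul)` generated by a set `S` of vectors: the smallest
linear code containing `S`. -/
def genCode {n : ℕ} (mul : Hring → Hring → Hring) (S : Set (Fin n → Hring)) :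
    Set (Fin n → Hring) :=
  ⋂₀ { C | IsLinearCode mul C ∧ S ⊆ C }

theorem mem_combCode_iff {n : ℕ} (A : Set (Fin n → ZMod 2)) (B : Set (Fin n → ZMod 3))
    (c : Fin n → Hring) :
    c ∈ combCode A B ↔ (fun i => (c i).1) ∈ A ∧ (fun i => (c i).2) ∈ B := by
  constructor
  · rintro ⟨x, hx, y, hy, rfl⟩
    simpa [aVec, bVec] using And.intro hx hy
  · rintro ⟨hx, hy⟩
    refine ⟨_, hx, _, hy, ?_⟩
    funext i
    simp [aVec, bVec]

theorem innerH_mul32 {n : ℕ} (x y : Fin n → Hring) :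
    innerH mul32 x y = (0, innerF (fun i => (x i).2) (fun i => (y i).2)) := by
  ext <;> simp [innerH, mul32, innerF, Prod.fst_sum, Prod.snd_sum]

theorem dualH_combCode {n : ℕ} (A : Set (Fin n → ZMod 2)) (hA : A.Nonempty)
    (B : Set (Fin n → ZMod 3)) :
    dualH mul32 (combCode A B) = combCode Set.univ (dualF B) := by
  ext c
  rw [mem_combCode_iff]
  simp only [dualH, dualF, Set.mem_setOf_eq, innerH_mul32, mem_combCode_iff, Set.mem_univ,
    true_and]
  constructor
  · intro h y hy
    obtain ⟨x, hx⟩ := hA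
    exact congrArg Prod.snd (h (fun i => (x i, y i)) ⟨hx, hy⟩)
  · rintro h x ⟨_, hx⟩
    rw [h _ hx]
    rfl

theorem dualF_dualF {n : ℕ} (C : Submodule (ZMod 3) (Fin n → ZMod 3)) :
    dualF (dualF (C : Set (Fin n → ZMod 3))) = C := by
  haveI : Fact (Nat.Prime 3) := ⟨Nat.prime_three⟩
  ext v
  constructor
  · intro h
    by_contra hv
    obtain ⟨f, hf, hC⟩ := Submodule.exists_le_ker_of_notMem (p := C) hv
    have key : ∀ x, f x = ∑ i, x i * f (Pi.single i 1) := by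
      intro x
      conv_lhs => rw [pi_eq_sum_univ' x]
      simp [map_sum]
    apply hf
    rw [key]
    have := h (fun i => f (Pi.single i 1)) (fun x hx => by
      have := hC hx
      rw [LinearMap.mem_ker, key] at this
      exact this)
    simpa [innerF, mul_comm] using this
  · intro h x hx
    have := hx v h
    simpa [innerF, mul_comm] using this

/-- For `C = a C_a ⊕ b C_b` over `H₃₂`, one has
`C^⊥ = a 𝔽₂ⁿ ⊕ b C_b^⊥`, and `(C^⊥)^⊥ = C` iff `C_a = 𝔽₂ⁿ`. -/
theorem dual_combCode_H32 {n : ℕ}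
    (Ca : Submodule (ZMod 2) (Fin n → ZMod 2)) (Cb : Submodule (ZMod 3) (Fin n → ZMod 3)) :
    dualH mul32 (combCode (Ca : Set (Fin n → ZMod 2)) (Cb : Set (Fin n → ZMod 3))) =
        combCode Set.univ (dualF (Cb : Set (Fin n → ZMod 3))) ∧
      (dualH mul32 (dualH mul32
          (combCode (Ca : Set (Fin n → ZMod 2)) (Cb : Set (Fin n → ZMod 3)))) =
          combCode (Ca : Set (Fin n → ZMod 2)) (Cb : Set (Fin n → ZMod 3)) ↔
        (Ca : Set (Fin n → ZMod 2)) = Set.univ) := by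
  have h1 := dualH_combCode (Ca : Set (Fin n → ZMod 2)) ⟨0, Ca.zero_mem⟩
    (Cb : Set (Fin n → ZMod 3))
  refine ⟨h1, ?_⟩
  rw [h1, dualH_combCode _ Set.univ_nonempty, dualF_dualF]
  constructor
  · intro h
    refine Set.eq_univ_of_forall fun x => ?_
    have hx : (fun i => ((x i, 0) : Hring)) ∈
        combCode (Set.univ : Set (Fin n → ZMod 2)) (Cb : Set (Fin n → ZMod 3)) :=
      (mem_combCode_iff _ _ _).2 ⟨Set.mem_univ _, Cb.zero_mem⟩
    rw [h, mem_combCode_iff] at hx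
    exact hx.1
  · intro h
    rw [h]
end

section
/- Let C = aC_a ⊕ bC_b be a linear code of length n over H_23, where C_a is a binary linear code and C_b a ternary linear code. Then C is quasi self-dual if and only if C_a is a self-dual binary code and C_b is a ternary code of dimension n/2 (equivalently |C_b| = 3^{n/2}). -/
/-- The dual of a binary code is a subspace of complementary dimension. -/
lemma exists_dual_submodule {n : ℕ} (Ca : Submodule (ZMod 2) (Fin n → ZMod 2)) :
    ∃ D : Submodule (ZMod 2) (Fin n → ZMod 2),
      (D : Set (Fin n → ZMod 2)) = dualF (Ca : Set (Fin n → ZMod 2)) ∧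
      Module.finrank (ZMod 2) Ca + Module.finrank (ZMod 2) D = n := by
  let B : LinearMap.BilinForm (ZMod 2) (Fin n → ZMod 2) := dotProductBilin (ZMod 2) (ZMod 2)
  have hB : ∀ x y, B x y = innerF x y := fun x y => rfl
  have hker : LinearMap.ker B = ⊥ := by
    rw [LinearMap.ker_eq_bot']
    intro x hx
    funext i
    have h := LinearMap.congr_fun hx (Pi.single i 1)
    rw [hB] at h
    simpa [innerF, Pi.single_apply] using h
  refine ⟨B.orthogonal Ca, ?_, ?_⟩
  · ext y
    rfl
  · have h := LinearMap.BilinForm.finrank_add_finrank_orthogonal' (B := B) Ca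
    rw [hker, inf_bot_eq, finrank_bot, add_zero] at h
    simpa using h

lemma card_combCode {n : ℕ}
    (Ca : Submodule (ZMod 2) (Fin n → ZMod 2)) (Cb : Submodule (ZMod 3) (Fin n → ZMod 3)) :
    Nat.card (combCode (Ca : Set (Fin n → ZMod 2)) (Cb : Set (Fin n → ZMod 3))) =
      Nat.card Ca * Nat.card Cb := by
  rw [← Nat.card_prod]
  symm
  refine Nat.card_eq_of_bijective
    (fun p : Ca × Cb => (⟨aVec p.1.1 + bVec p.2.1, p.1.1, p.1.2, p.2.1, p.2.2, rfl⟩ :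
      combCode (Ca : Set (Fin n → ZMod 2)) (Cb : Set (Fin n → ZMod 3)))) ⟨?_, ?_⟩
  · rintro ⟨⟨x, hx⟩, ⟨y, hy⟩⟩ ⟨⟨x', hx'⟩, ⟨y', hy'⟩⟩ h
    have h1 : aVec x + bVec y = aVec x' + bVec y' := congrArg Subtype.val h
    have h2 : x = x' := by
      funext i
      simpa [aVec, bVec] using congrArg Prod.fst (congrFun h1 i)
    have h3 : y = y' := by
      funext i
      simpa [aVec, bVec] using congrArg Prod.snd (congrFun h1 i)
    subst h2 h3
    rfl
  · rintro ⟨c, x, hx, y, hy, rfl⟩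
    exact ⟨⟨⟨x, hx⟩, ⟨y, hy⟩⟩, rfl⟩

lemma innerH_comb {n : ℕ} (x x' : Fin n → ZMod 2) (y y' : Fin n → ZMod 3) :
    innerH mul23 (aVec x + bVec y) (aVec x' + bVec y') = (innerF x x', 0) := by
  ext <;> simp [innerH, innerF, mul23, aVec, bVec, Prod.fst_sum, Prod.snd_sum]

lemma selfOrth_comb_iff {n : ℕ}
    (Ca : Submodule (ZMod 2) (Fin n → ZMod 2)) (Cb : Submodule (ZMod 3) (Fin n → ZMod 3)) :
    SelfOrthH mul23 (combCode (Ca : Set (Fin n → ZMod 2)) (Cb : Set (Fin n → ZMod 3))) ↔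
      (Ca : Set (Fin n → ZMod 2)) ⊆ dualF (Ca : Set (Fin n → ZMod 2)) := by
  constructor
  · intro h x hx x' hx'
    have := h _ ⟨x', hx', 0, Cb.zero_mem, rfl⟩ _ ⟨x, hx, 0, Cb.zero_mem, rfl⟩
    rw [innerH_comb] at this
    exact congrArg Prod.fst this
  · rintro h _ ⟨x, hx, y, hy, rfl⟩ _ ⟨x', hx', y', hy', rfl⟩
    rw [innerH_comb, h hx' x hx]
    rfl

lemma eq_rpow_half_iff (N q n : ℕ) :
    (N : ℝ) = (q : ℝ) ^ ((n : ℝ) / 2) ↔ N ^ 2 = q ^ n := by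
  have hq : (0 : ℝ) ≤ q := Nat.cast_nonneg q
  have h : ((q : ℝ) ^ ((n : ℝ) / 2)) ^ 2 = (q : ℝ) ^ n := by
    rw [← Real.rpow_natCast, ← Real.rpow_mul hq, ← Real.rpow_natCast]
    congr 1
    push_cast
    ring
  rw [← pow_left_inj₀ (Nat.cast_nonneg N) (Real.rpow_nonneg hq _) two_ne_zero, h]
  norm_cast

lemma two_three_exponents (k m n : ℕ) (h : (2 ^ k * 3 ^ m) ^ 2 = 6 ^ n) :
    2 * k = n ∧ 2 * m = n := by
  have hprod : 2 ^ (2 * k) * 3 ^ (2 * m) = 2 ^ n * 3 ^ n := by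
    rw [← mul_pow 2 3 n, pow_mul', pow_mul', ← mul_pow, h]
    norm_num
  have h2 : 2 ^ (2 * k) = 2 ^ n := by
    apply Nat.dvd_antisymm
    · exact (Nat.Coprime.pow _ _ (by norm_num : Nat.Coprime 2 3)).dvd_of_dvd_mul_right
        (Dvd.intro _ hprod)
    · exact (Nat.Coprime.pow _ _ (by norm_num : Nat.Coprime 2 3)).dvd_of_dvd_mul_right
        (Dvd.intro _ hprod.symm)
  refine ⟨Nat.pow_right_injective le_rfl h2, ?_⟩
  rw [h2] at hprod
  exact Nat.pow_right_injective (by norm_num : 2 ≤ 3) (Nat.eq_of_mul_eq_mul_left (by positivity) hprod)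

/-- A code `C = a C_a ⊕ b C_b` over `H₂₃` is quasi self-dual iff
`C_a` is a self-dual binary code and `C_b` has `3^(n/2)` elements
(i.e. is an `[n, n/2]` ternary code). -/
theorem qsd_iff_H23 {n : ℕ}
    (Ca : Submodule (ZMod 2) (Fin n → ZMod 2)) (Cb : Submodule (ZMod 3) (Fin n → ZMod 3)) :
    QSD mul23 (combCode (Ca : Set (Fin n → ZMod 2)) (Cb : Set (Fin n → ZMod 3))) ↔
      ((Ca : Set (Fin n → ZMod 2)) = dualF (Ca : Set (Fin n → ZMod 2)) ∧
        (Nat.card Cb : ℝ) = (3 : ℝ) ^ ((n : ℝ) / 2)) := by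
  obtain ⟨D, hD, hdim⟩ := exists_dual_submodule Ca
  have h6 := eq_rpow_half_iff (Nat.card Ca * Nat.card Cb) 6 n
  have h3 := eq_rpow_half_iff (Nat.card Cb) 3 n
  have ca : Nat.card Ca = 2 ^ Module.finrank (ZMod 2) Ca := by
    rw [Module.natCard_eq_pow_finrank (K := ZMod 2), Nat.card_zmod]
  have cb : Nat.card Cb = 3 ^ Module.finrank (ZMod 3) Cb := by
    rw [Module.natCard_eq_pow_finrank (K := ZMod 3), Nat.card_zmod]
  unfold QSD
  rw [selfOrth_comb_iff, card_combCode, ← hD]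
  rw [Nat.cast_ofNat] at h6 h3
  rw [h6, h3, ca, cb, SetLike.coe_subset_coe, SetLike.coe_set_eq]
  constructor
  · rintro ⟨hle, hc⟩
    obtain ⟨hk, hm⟩ := two_three_exponents _ _ _ hc
    refine ⟨Submodule.eq_of_le_of_finrank_eq hle (by omega), ?_⟩
    rw [← pow_mul', hm]
  · rintro ⟨he, hc⟩
    refine ⟨he.le, ?_⟩
    rw [← he] at hdim
    rw [mul_pow, hc, ← pow_mul', two_mul, hdim, ← mul_pow]
    norm_num
end

section
/- Let C₀ be a self-orthogonal linear code of length n over H_23 generated by vectors r₁, …, r_k ∈ H_23^n, let x ∈ {0,1,2}^n, and let β ∈ J_b = {0, b, 2b}. For 1 ≤ i ≤ k set y_i = Σ_{j=1}^n x_j r_{ij} ∈ H_23 (integer multiples in the additive group of H_23), and let βx ∈ H_23^n have j-th coordinate x_j·β. Then the linear code of length n + 3 over H_23 generated by the k + 3 vectors (β, 0, 0, βx), (0, β, 0, βx), (0, 0, β, βx), (2y₁, 2y₁, 2y₁, r₁), …, (2y_k, 2y_k, 2y_k, r_k) is self-orthogonal. -/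
theorem innerH23_eq_zero_iff {n : ℕ} (u v : Fin n → Hring) :
    innerH mul23 u v = 0 ↔ ∑ i, (u i).1 * (v i).1 = 0 := by
  unfold innerH mul23
  rw [Prod.ext_iff, Prod.fst_sum, Prod.snd_sum]
  simp

theorem isLinear_dual23 {n : ℕ} (S : Set (Fin n → Hring)) :
    IsLinearCode mul23 (dualH mul23 S) := by
  refine ⟨⟨0, ?_⟩, ?_, ?_⟩
  · intro u _
    rw [innerH23_eq_zero_iff]
    simp
  · intro u hu v hv w hw
    have h1 := hu w hw
    have h2 := hv w hw
    rw [innerH23_eq_zero_iff] at *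
    simp only [Pi.add_apply, Prod.fst_add, mul_add, Finset.sum_add_distrib, h1, h2, add_zero]
  · intro c u hu w hw
    have h1 := hu w hw
    rw [innerH23_eq_zero_iff] at *
    simp only [mul23, mul_left_comm _ c.1, ← Finset.mul_sum, h1, mul_zero]

theorem innerH23_comm {n : ℕ} (u v : Fin n → Hring) :
    innerH mul23 u v = innerH mul23 v u := by
  simp only [innerH, mul23, mul_comm]

theorem selfOrth_genCode23 {n : ℕ} (S : Set (Fin n → Hring)) (h : SelfOrthH mul23 S) :
    SelfOrthH mul23 (genCode mul23 S) := by
  have h1 : genCode mul23 S ⊆ dualH mul23 S :=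
    Set.sInter_subset_of_mem ⟨isLinear_dual23 S, fun v hv u hu => h u hu v hv⟩
  have h2 : genCode mul23 S ⊆ dualH mul23 (genCode mul23 S) :=
    Set.sInter_subset_of_mem ⟨isLinear_dual23 _, fun v hv u hu => by
      rw [innerH23_comm]; exact h1 hu v hv⟩
  exact fun u hu v hv => h2 hv u hu

/-- Build-up construction over `H₂₃`, second form: from a
self-orthogonal code of length `n` generated by `r₁, …, r_k`, a ternary vector `x`, and
`β ∈ J_b = {0, b, 2b}`, the code of length `n+3` generated by `(β,0,0,βx)`, `(0,β,0,βx)`,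
`(0,0,β,βx)` and the vectors `(2yᵢ, 2yᵢ, 2yᵢ, rᵢ)`
(with `yᵢ = (x, rᵢ) = ∑_j x_j • r_{ij}`) is self-orthogonal. -/
theorem buildup_H23_length_three {n k : ℕ}
    (C0 : Set (Fin n → Hring)) (r : Fin k → Fin n → Hring)
    (hgen : C0 = genCode mul23 (Set.range r))
    (hso : SelfOrthH mul23 C0)
    (x : Fin n → ZMod 3)
    (β : Hring) (hβ : β ∈ ({0, bH, bH + bH} : Set Hring))
    (y : Fin k → Hring)
    (hy : ∀ i, y i = ∑ j, (x j).val • r i j)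
    (βx : Fin n → Hring)
    (hβx : ∀ j, βx j = (x j).val • β) :
    SelfOrthH mul23 (genCode mul23
      (insert (Fin.cons β (Fin.cons 0 (Fin.cons 0 βx)) : Fin (n + 3) → Hring)
        (insert (Fin.cons 0 (Fin.cons β (Fin.cons 0 βx)) : Fin (n + 3) → Hring)
          (insert (Fin.cons 0 (Fin.cons 0 (Fin.cons β βx)) : Fin (n + 3) → Hring)
            (Set.range (fun i =>
              (Fin.cons (2 • y i) (Fin.cons (2 • y i) (Fin.cons (2 • y i) (r i))) :
                Fin (n + 3) → Hring))))))) := by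
  have hb : β.1 = 0 := by
    rcases hβ with h | h | h <;> rw [h] <;> simp [bH]
  have hbx : ∀ j, (βx j).1 = 0 := by
    intro j
    rw [hβx, Prod.smul_fst, hb, smul_zero]
  have h2 : ∀ i, (2 • y i).1 = 0 := by
    intro i
    rw [Prod.smul_fst]
    generalize (y i).1 = t
    revert t
    decide
  have hr : ∀ i j, ∑ l, (r i l).1 * (r j l).1 = 0 := by
    intro i j
    rw [← innerH23_eq_zero_iff]
    have hm : ∀ i, r i ∈ C0 := by
      intro i
      rw [hgen]
      exact fun C hC => hC.2 ⟨i, rfl⟩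
    exact hso _ (hm i) _ (hm j)
  apply selfOrth_genCode23
  intro u hu v hv
  rw [innerH23_eq_zero_iff]
  rcases hu with rfl | rfl | rfl | ⟨i, rfl⟩ <;> rcases hv with rfl | rfl | rfl | ⟨j, rfl⟩ <;>
    simp only [Fin.sum_univ_succ, Fin.cons_zero, Fin.cons_succ, hb, hbx, h2, hr, Prod.fst_zero,
      mul_zero, zero_mul, add_zero, Finset.sum_const_zero]
end
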